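/- Let r ≥ 1, α ∈ [0, r+1) with α ≠ 1, and m ≥ 2. Let μ be a nonatomic Borel probability measure on ℝ that is m-divisible with respect to pairwise disjoint measurable sets (A₁,…,A_m), with s_i = μ(A_i), μ_i = μ(·|A_i), and ∫|x|^r dμ_i(x) < ∞ for all i. For each i set t_i = s_i^{1/a₂}·(∑_{j=1}^m s_j^{a₁})^{−1/(1−α)}. Then limsup_{R→∞} e^{rR}·D^α_μ(R) ≤ ∑_{i=1}^m s_i·t_i^{−r}·limsup_{R→∞} e^{rR}·D^α_{μ_i}(R). -/

import Mathlib

open MeasureTheory Filter Set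
open scoped ENNReal Topology Classical

noncomputable section

/-- A scalar quantizer: a Borel measurable map `ℝ → ℝ` with countable range. -/
def IsQuantizer (q : ℝ → ℝ) : Prop :=
  Measurable q ∧ (Set.range q).Countable

/-- The Rényi entropy of order `α ∈ [-∞,∞]` of the quantizer `q` with respect to `μ`. -/
def renyiEntropy (α : EReal) (μ : Measure ℝ) (q : ℝ → ℝ) : EReal :=
  if α = ⊤ then
    - ENNReal.log (⨆ a : ℝ, μ (q ⁻¹' {a}))
  else if α = ⊥ then
    - ENNReal.log (⨅ a ∈ {a : ℝ | 0 < μ (q ⁻¹' {a})}, μ (q ⁻¹' {a}))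
  else if α = 1 then
    ((∑' a : ℝ, ENNReal.ofReal (-((μ (q ⁻¹' {a})).toReal * Real.log (μ (q ⁻¹' {a})).toReal)) : ℝ≥0∞) : EReal)
  else
    (((1 - α.toReal)⁻¹ : ℝ) : EReal) *
      ENNReal.log (∑' a : ℝ, if 0 < μ (q ⁻¹' {a}) then μ (q ⁻¹' {a}) ^ α.toReal else 0)

/-- The `r`-th power distortion of the quantizer `q` with respect to `μ`. -/
def distortion (r : ℝ) (μ : Measure ℝ) (q : ℝ → ℝ) : ℝ≥0∞ :=
  ∫⁻ x, ENNReal.ofReal (|x - q x| ^ r) ∂μ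

/-- The optimal quantization error under Rényi entropy constraint `R` of order `α`. -/
def optErr (r : ℝ) (α : EReal) (μ : Measure ℝ) (R : ℝ) : ℝ≥0∞ :=
  ⨅ (q : ℝ → ℝ) (_ : IsQuantizer q ∧ renyiEntropy α μ q ≤ (R : EReal)), distortion r μ q

/-- The (topological) support of a measure on `ℝ`. -/
def msupport (μ : Measure ℝ) : Set ℝ :=
  {x : ℝ | ∀ ε > 0, 0 < μ (Set.Ioo (x - ε) (x + ε))}

/-- The constant `C(r) = 1/((1+r)2^r)`. -/
def Cr (r : ℝ) : ℝ := 1 / ((1 + r) * 2 ^ r)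

/-- `a₁ = (1-α+αr)/(1-α+r)`. -/
def a1 (α r : ℝ) : ℝ := (1 - α + α * r) / (1 - α + r)

/-- `a₂ = (1-α+r)/(1-α)`. -/
def a2 (α r : ℝ) : ℝ := (1 - α + r) / (1 - α)

/-- The class `Q^c`: quantizers with finitely many codecells, each an interval,
with each codepoint in the closure of its codecell. -/
def Qc (q : ℝ → ℝ) : Prop :=
  Measurable q ∧ (Set.range q).Finite ∧
    ∀ a ∈ Set.range q, (q ⁻¹' {a}).OrdConnected ∧ a ∈ closure (q ⁻¹' {a})

/-- The compressor associated with a point density `g`. -/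
def compressor (g : ℝ → ℝ) (x : ℝ) : ℝ := ∫ y in Set.Iic x, g y

/-- The generalized inverse of the compressor of `g`, extended to `[0,1]` by the
endpoints of the support of `g·λ`. -/
def geninv (g : ℝ → ℝ) (y : ℝ) : ℝ :=
  if y ≤ 0 then sInf (msupport (volume.withDensity fun x => ENNReal.ofReal (g x)))
  else if 1 ≤ y then sSup (msupport (volume.withDensity fun x => ENNReal.ofReal (g x)))
  else sSup {x : ℝ | compressor g x ≤ y}

/-- The `N`-level uniform quantizer on `[0,1]`: each cell `((i-1)/N, i/N]`
(the first cell being `[0,1/N]`) is mapped to its midpoint `(2i-1)/(2N)`. -/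
def uniformQ (N : ℕ) (x : ℝ) : ℝ :=
  ((2 * max 1 ⌈x * (N : ℝ)⌉ - 1 : ℤ) : ℝ) / (2 * (N : ℝ))

/-- The `N`-level companding quantizer with point density `g`. -/
def compand (g : ℝ → ℝ) (N : ℕ) (x : ℝ) : ℝ :=
  geninv g (uniformQ N (compressor g x))

/-- The infinite-level uniform quantizer with step `Δ`, mapping `(iΔ,(i+1)Δ]` to `(i+1/2)Δ`. -/
def unifQ (Δ : ℝ) (x : ℝ) : ℝ := (((⌈x / Δ⌉ : ℤ) : ℝ) - 1 / 2) * Δ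

/-- The quantizer obtained from `unifQ Δ` by keeping only codecells entirely inside `M`. -/
def unifQres (Δ : ℝ) (M : Set ℝ) (x : ℝ) : ℝ :=
  if unifQ Δ ⁻¹' {unifQ Δ x} ⊆ M then unifQ Δ x else 0

/-- The Rényi differential entropy of order `α ∈ ℝ` of `μ` with density `f`. -/
def diffEntropyR (α : ℝ) (μ : Measure ℝ) (f : ℝ → ℝ) : ℝ :=
  if α = 1 then -∫ x, f x * Real.log (f x)
  else (1 - α)⁻¹ * Real.log (∫ x in msupport μ, f x ^ α)

/-- The Rényi relative entropy of order `α ∈ [-∞,∞)` between `μ = f·λ` and `ν = g·λ`. -/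
def relEntropyR (α : EReal) (μ : Measure ℝ) (f g : ℝ → ℝ) : ℝ :=
  if α = ⊥ then
    Real.log (essInf (fun x => f x / g x)
      (volume.restrict (Set.Ioo (sInf (msupport μ)) (sSup (msupport μ)))))
  else if α = 1 then ∫ x in {x : ℝ | 0 < f x}, f x * Real.log (f x / g x)
  else (α.toReal - 1)⁻¹ *
    Real.log (∫ x in {x : ℝ | 0 < f x}, f x ^ α.toReal * g x ^ (1 - α.toReal))

/-- The power `x ^ α`, set to zero at `x = 0` also when `α = 0`. -/
def cellPow (α : ℝ) (x : ℝ≥0∞) : ℝ≥0∞ := if 0 < x then x ^ α else 0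

lemma cellPow_zero (α : ℝ) : cellPow α 0 = 0 := by simp [cellPow]

lemma cellPow_mul {α : ℝ} (hα : 0 ≤ α) {s : ℝ≥0∞} (hs : 0 < s) (x : ℝ≥0∞) :
    cellPow α (s * x) = s ^ α * cellPow α x := by
  rcases eq_or_ne x 0 with rfl | hx
  · simp [cellPow_zero]
  · have hx' : 0 < x := pos_iff_ne_zero.2 hx
    have hsx : 0 < s * x := ENNReal.mul_pos hs.ne' hx
    simp only [cellPow, hx', hsx, if_true, ENNReal.mul_rpow_of_nonneg _ _ hα]

lemma cellPow_add_le {α : ℝ} (hα : 0 ≤ α) (hα1 : α ≤ 1) (x y : ℝ≥0∞) :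
    cellPow α (x + y) ≤ cellPow α x + cellPow α y := by
  rcases eq_or_ne x 0 with rfl | hx
  · simp [cellPow_zero]
  rcases eq_or_ne y 0 with rfl | hy
  · simp [cellPow_zero]
  have hx' : 0 < x := pos_iff_ne_zero.2 hx
  have hy' : 0 < y := pos_iff_ne_zero.2 hy
  have hxy : 0 < x + y := hx'.trans_le le_self_add
  simp only [cellPow, hx', hy', hxy, if_true]
  exact ENNReal.rpow_add_le_add_rpow x y hα hα1

lemma le_cellPow_add {α : ℝ} (hα1 : 1 ≤ α) (x y : ℝ≥0∞) :
    cellPow α x + cellPow α y ≤ cellPow α (x + y) := by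
  rcases eq_or_ne x 0 with rfl | hx
  · simp [cellPow_zero]
  rcases eq_or_ne y 0 with rfl | hy
  · simp [cellPow_zero]
  have hx' : 0 < x := pos_iff_ne_zero.2 hx
  have hy' : 0 < y := pos_iff_ne_zero.2 hy
  have hxy : 0 < x + y := hx'.trans_le le_self_add
  simp only [cellPow, hx', hy', hxy, if_true]
  exact ENNReal.add_rpow_le_rpow_add x y hα1

lemma cellPow_sum_le {ι : Type*} {α : ℝ} (hα : 0 ≤ α) (hα1 : α ≤ 1) (s : Finset ι)
    (g : ι → ℝ≥0∞) : cellPow α (∑ i ∈ s, g i) ≤ ∑ i ∈ s, cellPow α (g i) :=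
  Finset.le_sum_of_subadditive _ (cellPow_zero α).le (cellPow_add_le hα hα1) s g

lemma sum_cellPow_le {ι : Type*} {α : ℝ} (hα1 : 1 ≤ α) (s : Finset ι)
    (g : ι → ℝ≥0∞) : ∑ i ∈ s, cellPow α (g i) ≤ cellPow α (∑ i ∈ s, g i) := by
  induction s using Finset.cons_induction with
  | empty => simp
  | cons i s hi ih =>
    rw [Finset.sum_cons, Finset.sum_cons]
    exact (add_le_add_right ih _).trans (le_cellPow_add hα1 _ _)

/-- The sum of the `α`-th powers of the cell probabilities. -/
def cellPowSum (α : ℝ) (μ : Measure ℝ) (q : ℝ → ℝ) : ℝ≥0∞ :=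
  ∑' a : ℝ, cellPow α (μ (q ⁻¹' {a}))

lemma ennreal_log_ofReal_exp (x : ℝ) : ENNReal.log (ENNReal.ofReal (Real.exp x)) = x := by
  rw [ENNReal.log_ofReal_of_pos (Real.exp_pos x), Real.log_exp]

lemma renyiEntropy_coe {α : ℝ} (hα1 : α ≠ 1) (μ : Measure ℝ) (q : ℝ → ℝ) :
    renyiEntropy (α : EReal) μ q =
      (((1 - α)⁻¹ : ℝ) : EReal) * ENNReal.log (cellPowSum α μ q) := by
  have h1 : (α : EReal) ≠ 1 := by exact_mod_cast hα1
  simp only [renyiEntropy, EReal.coe_ne_top, EReal.coe_ne_bot, h1, if_false, EReal.toReal_coe,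
    cellPowSum, cellPow]

lemma renyiEntropy_le_iff_of_lt_one {α : ℝ} (hα1 : α < 1) (μ : Measure ℝ) (q : ℝ → ℝ) (R : ℝ) :
    renyiEntropy (α : EReal) μ q ≤ R ↔
      cellPowSum α μ q ≤ ENNReal.ofReal (Real.exp ((1 - α) * R)) := by
  have hc : 0 < 1 - α := sub_pos.2 hα1
  rw [renyiEntropy_coe hα1.ne, ← ENNReal.log_le_log_iff, ennreal_log_ofReal_exp]
  induction ENNReal.log (cellPowSum α μ q) using EReal.rec with
  | bot => simp [EReal.coe_mul_bot_of_pos (inv_pos.2 hc)]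
  | top =>
    rw [EReal.coe_mul_top_of_pos (inv_pos.2 hc)]
    simp only [top_le_iff, EReal.coe_ne_top]
  | coe x =>
    rw [← EReal.coe_mul, EReal.coe_le_coe_iff, EReal.coe_le_coe_iff, inv_mul_le_iff₀ hc]

lemma renyiEntropy_le_iff_of_one_lt {α : ℝ} (hα1 : 1 < α) (μ : Measure ℝ) (q : ℝ → ℝ) (R : ℝ) :
    renyiEntropy (α : EReal) μ q ≤ R ↔
      ENNReal.ofReal (Real.exp ((1 - α) * R)) ≤ cellPowSum α μ q := by
  have hc : 1 - α < 0 := sub_neg.2 hα1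
  rw [renyiEntropy_coe hα1.ne', ← ENNReal.log_le_log_iff, ennreal_log_ofReal_exp]
  induction ENNReal.log (cellPowSum α μ q) using EReal.rec with
  | bot =>
    rw [EReal.coe_mul_bot_of_neg (inv_lt_zero.2 hc)]
    simp only [top_le_iff, le_bot_iff, EReal.coe_ne_top, EReal.coe_ne_bot]
  | top => simp [EReal.coe_mul_top_of_neg (inv_lt_zero.2 hc)]
  | coe x =>
    rw [← EReal.coe_mul, EReal.coe_le_coe_iff, EReal.coe_le_coe_iff, inv_mul_eq_div,
      div_le_iff_of_neg hc, mul_comm]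

/-- The quantizer that agrees with `q i` on `A i` and vanishes elsewhere. -/
def glue {m : ℕ} (A : Fin m → Set ℝ) (q : Fin m → ℝ → ℝ) (x : ℝ) : ℝ :=
  ∑ i, (A i).indicator (q i) x

section Glue

variable {m : ℕ} {A : Fin m → Set ℝ} {q : Fin m → ℝ → ℝ}

lemma glue_of_mem (hdisj : Pairwise (Function.onFun Disjoint A)) {i : Fin m} {x : ℝ}
    (hx : x ∈ A i) : glue A q x = q i x := by
  rw [glue, Finset.sum_eq_single i, Set.indicator_of_mem hx]
  · exact fun j _ hj => Set.indicator_of_notMem (Set.disjoint_right.1 (hdisj hj) hx) _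
  · simp

lemma isQuantizer_glue (hA : ∀ i, MeasurableSet (A i))
    (hdisj : Pairwise (Function.onFun Disjoint A)) (hq : ∀ i, IsQuantizer (q i)) :
    IsQuantizer (glue A q) := by
  refine ⟨Finset.measurable_sum _ fun i _ => (hq i).1.indicator (hA i), ?_⟩
  refine ((Set.countable_iUnion fun i => (hq i).2).union (Set.countable_singleton 0)).mono ?_
  rintro _ ⟨x, rfl⟩
  by_cases hx : ∃ i, x ∈ A i
  · obtain ⟨i, hi⟩ := hx
    exact Or.inl (Set.mem_iUnion.2 ⟨i, x, (glue_of_mem hdisj hi).symm⟩)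
  · push Not at hx
    exact Or.inr (Finset.sum_eq_zero fun i _ => Set.indicator_of_notMem (hx i) _)

variable {μ : Measure ℝ}

lemma lintegral_eq_sum_restrict [IsProbabilityMeasure μ] (hA : ∀ i, MeasurableSet (A i))
    (hdisj : Pairwise (Function.onFun Disjoint A)) (hcover : μ (⋃ i, A i) = 1)
    (f : ℝ → ℝ≥0∞) : ∫⁻ x, f x ∂μ = ∑ i, ∫⁻ x in A i, f x ∂μ := by
  have hae : ∀ᵐ x ∂μ, x ∈ ⋃ i, A i :=
    (prob_compl_eq_zero_iff (MeasurableSet.iUnion hA)).2 hcover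
  rw [← tsum_fintype (L := .unconditional _), ← lintegral_iUnion hA hdisj,
    Measure.restrict_eq_self_of_ae_mem hae]

lemma smul_cond_eq_restrict [IsFiniteMeasure μ] {B : Set ℝ} (hB : 0 < μ B) :
    μ B • ((μ B)⁻¹ • μ.restrict B) = μ.restrict B := by
  rw [smul_smul, ENNReal.mul_inv_cancel hB.ne' (measure_ne_top μ B), one_smul]

lemma distortion_glue [IsProbabilityMeasure μ] (r : ℝ) (hA : ∀ i, MeasurableSet (A i))
    (hdisj : Pairwise (Function.onFun Disjoint A)) (hpos : ∀ i, 0 < μ (A i))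
    (hcover : μ (⋃ i, A i) = 1) :
    distortion r μ (glue A q) =
      ∑ i, μ (A i) * distortion r ((μ (A i))⁻¹ • μ.restrict (A i)) (q i) := by
  rw [distortion, lintegral_eq_sum_restrict hA hdisj hcover]
  refine Finset.sum_congr rfl fun i _ => ?_
  rw [distortion, ← smul_eq_mul, ← lintegral_smul_measure, smul_cond_eq_restrict (hpos i)]
  exact setLIntegral_congr_fun (hA i) fun x hx => by rw [glue_of_mem hdisj hx]

lemma measure_glue_preimage [IsProbabilityMeasure μ] (hA : ∀ i, MeasurableSet (A i))
    (hdisj : Pairwise (Function.onFun Disjoint A)) (hpos : ∀ i, 0 < μ (A i))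
    (hcover : μ (⋃ i, A i) = 1) (hq : ∀ i, IsQuantizer (q i)) (a : ℝ) :
    μ (glue A q ⁻¹' {a}) =
      ∑ i, μ (A i) * ((μ (A i))⁻¹ • μ.restrict (A i)) (q i ⁻¹' {a}) := by
  have hm : MeasurableSet (glue A q ⁻¹' {a}) :=
    (isQuantizer_glue hA hdisj hq).1 (measurableSet_singleton a)
  rw [← lintegral_indicator_one hm, lintegral_eq_sum_restrict hA hdisj hcover]
  refine Finset.sum_congr rfl fun i _ => ?_
  rw [lintegral_indicator_one hm, ← smul_eq_mul, ← Measure.smul_apply,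
    smul_cond_eq_restrict (hpos i), Measure.restrict_apply hm,
    Measure.restrict_apply ((hq i).1 (measurableSet_singleton a))]
  congr 1
  ext x
  simp only [Set.mem_inter_iff, Set.mem_preimage, Set.mem_singleton_iff]
  exact and_congr_left fun hx => by rw [glue_of_mem hdisj hx]

lemma sum_rpow_mul_cellPowSum {α : ℝ} (hα : 0 ≤ α) (hpos : ∀ i, 0 < μ (A i)) :
    ∑ i, μ (A i) ^ α * cellPowSum α ((μ (A i))⁻¹ • μ.restrict (A i)) (q i) =
      ∑' a : ℝ, ∑ i, cellPow α (μ (A i) * ((μ (A i))⁻¹ • μ.restrict (A i)) (q i ⁻¹' {a})) := by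
  rw [Summable.tsum_finsetSum fun _ _ => ENNReal.summable]
  simp only [cellPowSum, cellPow_mul hα (hpos _), ENNReal.tsum_mul_left]

lemma renyiEntropy_glue_le [IsProbabilityMeasure μ] {α : ℝ} (hα : 0 ≤ α) (hα1 : α ≠ 1)
    (hA : ∀ i, MeasurableSet (A i)) (hdisj : Pairwise (Function.onFun Disjoint A))
    (hpos : ∀ i, 0 < μ (A i)) (hcover : μ (⋃ i, A i) = 1) (hq : ∀ i, IsQuantizer (q i))
    {R : ℝ} {ρ : Fin m → ℝ}
    (hρ : ∑ i, (μ (A i)).toReal ^ α * Real.exp ((1 - α) * ρ i) = Real.exp ((1 - α) * R))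
    (hH : ∀ i, renyiEntropy (α : EReal) ((μ (A i))⁻¹ • μ.restrict (A i)) (q i) ≤ ρ i) :
    renyiEntropy (α : EReal) μ (glue A q) ≤ R := by
  have hρ' : ENNReal.ofReal (Real.exp ((1 - α) * R)) =
      ∑ i, μ (A i) ^ α * ENNReal.ofReal (Real.exp ((1 - α) * ρ i)) := by
    rw [← hρ, ENNReal.ofReal_sum_of_nonneg fun i _ => by positivity]
    refine Finset.sum_congr rfl fun i _ => ?_
    rw [ENNReal.ofReal_mul (by positivity),
      ← ENNReal.ofReal_rpow_of_nonneg ENNReal.toReal_nonneg hα,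
      ENNReal.ofReal_toReal (measure_ne_top μ _)]
  rcases hα1.lt_or_gt with h | h
  · simp only [renyiEntropy_le_iff_of_lt_one h] at hH ⊢
    rw [hρ']
    calc cellPowSum α μ (glue A q)
        ≤ ∑' a : ℝ, ∑ i,
            cellPow α (μ (A i) * ((μ (A i))⁻¹ • μ.restrict (A i)) (q i ⁻¹' {a})) :=
          ENNReal.tsum_le_tsum fun a => by
            rw [measure_glue_preimage hA hdisj hpos hcover hq]
            exact cellPow_sum_le hα h.le _ _
      _ = _ := (sum_rpow_mul_cellPowSum hα hpos).symm
      _ ≤ _ := Finset.sum_le_sum fun i _ => mul_le_mul_right (hH i) _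
  · simp only [renyiEntropy_le_iff_of_one_lt h] at hH ⊢
    rw [hρ']
    calc _ ≤ _ := Finset.sum_le_sum fun i _ => mul_le_mul_right (hH i) _
      _ = ∑' a : ℝ, ∑ i,
            cellPow α (μ (A i) * ((μ (A i))⁻¹ • μ.restrict (A i)) (q i ⁻¹' {a})) :=
          sum_rpow_mul_cellPowSum hα hpos
      _ ≤ cellPowSum α μ (glue A q) :=
          ENNReal.tsum_le_tsum fun a => by
            rw [measure_glue_preimage hA hdisj hpos hcover hq]
            exact sum_cellPow_le h.le _ _

lemma optErr_le_sum [IsProbabilityMeasure μ] (r : ℝ) {α : ℝ} (hα : 0 ≤ α) (hα1 : α ≠ 1)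
    (hA : ∀ i, MeasurableSet (A i)) (hdisj : Pairwise (Function.onFun Disjoint A))
    (hpos : ∀ i, 0 < μ (A i)) (hcover : μ (⋃ i, A i) = 1) {R : ℝ} {ρ : Fin m → ℝ}
    (hρ : ∑ i, (μ (A i)).toReal ^ α * Real.exp ((1 - α) * ρ i) = Real.exp ((1 - α) * R)) :
    optErr r (α : EReal) μ R ≤
      ∑ i, μ (A i) * optErr r (α : EReal) ((μ (A i))⁻¹ • μ.restrict (A i)) (ρ i) := by
  refine ENNReal.le_of_forall_pos_le_add fun ε hε hfin => ?_
  have hlt : ∀ i, optErr r (α : EReal) ((μ (A i))⁻¹ • μ.restrict (A i)) (ρ i) <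
      optErr r (α : EReal) ((μ (A i))⁻¹ • μ.restrict (A i)) (ρ i) + ε := fun i =>
    ENNReal.lt_add_right
      (fun htop => (ENNReal.sum_lt_top.1 hfin i (Finset.mem_univ i)).ne
        (by rw [htop, ENNReal.mul_top (hpos i).ne']))
      (ENNReal.coe_pos.2 hε).ne'
  have hex : ∀ i, ∃ q : ℝ → ℝ,
      (IsQuantizer q ∧ renyiEntropy (α : EReal) ((μ (A i))⁻¹ • μ.restrict (A i)) q ≤ ρ i) ∧
      distortion r ((μ (A i))⁻¹ • μ.restrict (A i)) q <
        optErr r (α : EReal) ((μ (A i))⁻¹ • μ.restrict (A i)) (ρ i) + ε := fun i => by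
    obtain ⟨q, hq⟩ := iInf_lt_iff.1 (hlt i)
    obtain ⟨hq1, hq2⟩ := iInf_lt_iff.1 hq
    exact ⟨q, hq1, hq2⟩
  choose q hq hD using hex
  have hsum : ∑ i, μ (A i) = 1 := by
    rw [← hcover, measure_iUnion hdisj hA, tsum_fintype]
  calc optErr r (α : EReal) μ R ≤ distortion r μ (glue A q) :=
        iInf₂_le _ ⟨isQuantizer_glue hA hdisj fun i => (hq i).1,
          renyiEntropy_glue_le hα hα1 hA hdisj hpos hcover (fun i => (hq i).1) hρ
            fun i => (hq i).2⟩
    _ = _ := distortion_glue r hA hdisj hpos hcover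
    _ ≤ ∑ i, μ (A i) *
          (optErr r (α : EReal) ((μ (A i))⁻¹ • μ.restrict (A i)) (ρ i) + ε) :=
        Finset.sum_le_sum fun i _ => mul_le_mul_right (hD i).le _
    _ = _ := by simp only [mul_add, Finset.sum_add_distrib, ← Finset.sum_mul, hsum, one_mul]

end Glue

lemma ennreal_limsup_add_le {ι : Type*} (f : Filter ι) (u v : ι → ℝ≥0∞) :
    limsup (fun x => u x + v x) f ≤ limsup u f + limsup v f := by
  refine ENNReal.le_of_forall_pos_le_add fun ε hε hfin => ?_
  obtain ⟨hu, hv⟩ := ENNReal.add_lt_top.1 hfin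
  have hε2 : (ε / 2 : ℝ≥0∞) ≠ 0 := (ENNReal.half_pos (ENNReal.coe_pos.2 hε).ne').ne'
  refine limsup_le_of_le (h := ?_)
  filter_upwards [eventually_lt_of_limsup_lt (ENNReal.lt_add_right hu.ne hε2),
    eventually_lt_of_limsup_lt (ENNReal.lt_add_right hv.ne hε2)] with x hux hvx
  calc u x + v x ≤ (limsup u f + ε / 2) + (limsup v f + ε / 2) := add_le_add hux.le hvx.le
    _ = limsup u f + limsup v f + ε := by rw [add_add_add_comm, ENNReal.add_halves]

lemma ennreal_limsup_sum_le {ι κ : Type*} (f : Filter ι) (s : Finset κ) (u : κ → ι → ℝ≥0∞) :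
    limsup (fun x => ∑ i ∈ s, u i x) f ≤ ∑ i ∈ s, limsup (u i) f := by
  induction s using Finset.cons_induction with
  | empty =>
    simp only [Finset.sum_empty]
    exact limsup_le_of_le (h := Eventually.of_forall fun _ => le_rfl)
  | cons i s hi ih =>
    simp only [Finset.sum_cons]
    exact (ennreal_limsup_add_le f _ _).trans (add_le_add_right ih _)

lemma limsup_add_right_atTop (u : ℝ → ℝ≥0∞) (c : ℝ) :
    limsup (fun R => u (R + c)) atTop = limsup u atTop := by
  conv_rhs => rw [← (OrderIso.addRight c).map_atTop]
  rfl

/-- The weights `t i` balance the entropy contributions of the components of a mixture. -/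
lemma sum_rpow_mul_weight_rpow {m : ℕ} {r α : ℝ} (hα : α < r + 1) (hα1 : α ≠ 1) (hm : 0 < m)
    {s : Fin m → ℝ} (hs : ∀ i, 0 < s i) :
    ∑ i, s i ^ α * (s i ^ (1 / a2 α r) * (∑ j, s j ^ a1 α r) ^ (-(1 - α)⁻¹)) ^ (1 - α) = 1 := by
  have h1 : 1 - α ≠ 0 := sub_ne_zero.2 hα1.symm
  have h2 : 1 - α + r ≠ 0 := by linarith
  have : Nonempty (Fin m) := ⟨⟨0, hm⟩⟩
  have hS : 0 < ∑ j, s j ^ a1 α r :=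
    Finset.sum_pos (fun j _ => Real.rpow_pos_of_pos (hs j) _) Finset.univ_nonempty
  have hterm : ∀ i,
      s i ^ α * (s i ^ (1 / a2 α r) * (∑ j, s j ^ a1 α r) ^ (-(1 - α)⁻¹)) ^ (1 - α) =
        s i ^ a1 α r * (∑ j, s j ^ a1 α r)⁻¹ := fun i => by
    rw [Real.mul_rpow (Real.rpow_nonneg (hs i).le _) (Real.rpow_nonneg hS.le _),
      ← Real.rpow_mul (hs i).le, ← Real.rpow_mul hS.le, ← mul_assoc, ← Real.rpow_add (hs i),
      neg_mul, inv_mul_cancel₀ h1, Real.rpow_neg_one]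
    congr 2
    rw [a1, a2]
    field_simp
    ring
  rw [Finset.sum_congr rfl fun i _ => hterm i, ← Finset.sum_mul, mul_inv_cancel₀ hS.ne']

/-- limsup upper bound for mixtures. -/
theorem statement17
    (r : ℝ) (hr : 1 ≤ r) (α : ℝ) (hα : α ∈ Set.Ico (0 : ℝ) (r + 1)) (hα1 : α ≠ 1)
    (m : ℕ) (hm : 2 ≤ m)
    (μ : Measure ℝ) [IsProbabilityMeasure μ]
    (hna : ∀ x : ℝ, μ {x} = 0)
    (A : Fin m → Set ℝ) (hAmeas : ∀ i, MeasurableSet (A i))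
    (hdisj : Pairwise (Function.onFun Disjoint A))
    (hpos : ∀ i, 0 < μ (A i)) (hcover : μ (⋃ i, A i) = 1)
    (hmom : ∀ i, Integrable (fun x => |x| ^ r) ((μ (A i))⁻¹ • μ.restrict (A i))) :
    Filter.limsup
        (fun R : ℝ => ENNReal.ofReal (Real.exp (r * R)) * optErr r (α : EReal) μ R) atTop ≤
      ∑ i, ENNReal.ofReal ((μ (A i)).toReal *
          ((μ (A i)).toReal ^ (1 / a2 α r) *
            (∑ j, (μ (A j)).toReal ^ a1 α r) ^ (-(1 - α)⁻¹)) ^ (-r)) *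
        Filter.limsup
          (fun R : ℝ => ENNReal.ofReal (Real.exp (r * R)) *
            optErr r (α : EReal) ((μ (A i))⁻¹ • μ.restrict (A i)) R) atTop := by
  have hs : ∀ i, 0 < (μ (A i)).toReal := fun i =>
    ENNReal.toReal_pos (hpos i).ne' (measure_ne_top μ _)
  set t : Fin m → ℝ := fun i =>
    (μ (A i)).toReal ^ (1 / a2 α r) * (∑ j, (μ (A j)).toReal ^ a1 α r) ^ (-(1 - α)⁻¹) with ht
  have ht0 : ∀ i, 0 < t i := fun i => by
    have hS : 0 < ∑ j, (μ (A j)).toReal ^ a1 α r :=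
      Finset.sum_pos (fun j _ => Real.rpow_pos_of_pos (hs j) _) ⟨i, Finset.mem_univ i⟩
    exact mul_pos (Real.rpow_pos_of_pos (hs i) _) (Real.rpow_pos_of_pos hS _)
  have hsum : ∑ i, (μ (A i)).toReal ^ α * t i ^ (1 - α) = 1 :=
    sum_rpow_mul_weight_rpow hα.2 hα1 (by omega) hs
  set F : Fin m → ℝ → ℝ≥0∞ := fun i R => ENNReal.ofReal (Real.exp (r * R)) *
    optErr r (α : EReal) ((μ (A i))⁻¹ • μ.restrict (A i)) R with hF
  have hbound : ∀ R : ℝ, ENNReal.ofReal (Real.exp (r * R)) * optErr r (α : EReal) μ R ≤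
      ∑ i, ENNReal.ofReal ((μ (A i)).toReal * t i ^ (-r)) * F i (R + Real.log (t i)) := by
    intro R
    have hρ : ∑ i, (μ (A i)).toReal ^ α * Real.exp ((1 - α) * (R + Real.log (t i))) =
        Real.exp ((1 - α) * R) := by
      refine Eq.trans ?_ (congrArg (· * Real.exp ((1 - α) * R)) hsum |>.trans (one_mul _))
      rw [Finset.sum_mul]
      refine Finset.sum_congr rfl fun i _ => ?_
      rw [mul_add, Real.exp_add, Real.rpow_def_of_pos (ht0 i), mul_comm (Real.log (t i))]
      ring
    refine (mul_le_mul_right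
      (optErr_le_sum r hα.1 hα1 hAmeas hdisj hpos hcover hρ) _).trans_eq ?_
    rw [Finset.mul_sum]
    refine Finset.sum_congr rfl fun i _ => ?_
    have hexp : Real.exp (r * R) * (μ (A i)).toReal =
        (μ (A i)).toReal * t i ^ (-r) * Real.exp (r * (R + Real.log (t i))) := by
      rw [Real.rpow_def_of_pos (ht0 i), mul_assoc, ← Real.exp_add, mul_comm]
      congr 2
      ring
    rw [hF, ← mul_assoc, ← mul_assoc, ← ENNReal.ofReal_mul
      (mul_nonneg (hs i).le (Real.rpow_nonneg (ht0 i).le _)), ← hexp,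
      ENNReal.ofReal_mul (Real.exp_pos _).le, ENNReal.ofReal_toReal (measure_ne_top μ _)]
  calc _ ≤ limsup (fun R : ℝ => ∑ i,
          ENNReal.ofReal ((μ (A i)).toReal * t i ^ (-r)) * F i (R + Real.log (t i))) atTop :=
        limsup_le_limsup (Eventually.of_forall hbound)
    _ ≤ ∑ i, limsup (fun R : ℝ =>
          ENNReal.ofReal ((μ (A i)).toReal * t i ^ (-r)) * F i (R + Real.log (t i))) atTop :=
        ennreal_limsup_sum_le _ _ _
    _ = _ := Finset.sum_congr rfl fun i _ => by
        rw [ENNReal.limsup_const_mul_of_ne_top ENNReal.ofReal_ne_top,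
          limsup_add_right_atTop (F i)]

end
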